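/- Let (y_j)_{j=1}^n be a finite sequence of real numbers with ∑_{j=1}^n y_j = 0, let S_i = ∑_{j=1}^i y_j denote its partial sums, and let m ∈ {1,…,n} be any index minimizing the partial sums, i.e., S_i ≥ S_m for all i ∈ {1,…,n}. Let k* be the cyclic successor of m in {1,…,n} (that is, k* = m+1 if m < n and k* = 1 if m = n). Then T_i(k*) ≥ 0 for all i ∈ {1,…,n}. -/

import Mathlib

/-- The partial sum with wrapping `T_i(k)`: the sum of the `i` consecutive terms of the
sequence `y` (indexed `1,…,n`) starting at index `k`, indices taken cyclically modulo `n`. -/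
def wrapSum (n : ℕ) (y : ℕ → ℝ) (k i : ℕ) : ℝ :=
  ∑ j ∈ Finset.range i, y ((k - 1 + j) % n + 1)

/-- The ordinary partial sum `S_i = ∑_{j=1}^i y_j`. -/
def partialSum (y : ℕ → ℝ) (i : ℕ) : ℝ :=
  ∑ j ∈ Finset.Icc 1 i, y j

theorem partialSum_zero (y : ℕ → ℝ) : partialSum y 0 = 0 := by
  simp [partialSum]

theorem partialSum_succ (y : ℕ → ℝ) (i : ℕ) :
    partialSum y (i + 1) = partialSum y i + y (i + 1) :=
  Finset.sum_Icc_succ_top (by omega) y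

/-- If the total sum vanishes, the partial sums extend periodically. -/
theorem partialSum_succ_mod {n : ℕ} (hn : 1 ≤ n) {y : ℕ → ℝ} (h : partialSum y n = 0) (a : ℕ) :
    partialSum y ((a + 1) % n) = partialSum y (a % n + 1) := by
  have hlt : a % n < n := Nat.mod_lt a hn
  rw [← Nat.mod_add_mod]
  rcases Nat.lt_or_ge (a % n + 1) n with hc | hc
  · rw [Nat.mod_eq_of_lt hc]
  · have he : a % n + 1 = n := by omega
    rw [he, Nat.mod_self, h, partialSum_zero]

/-- If the total sum vanishes, a wrapped sum is a difference of two partial sums. -/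
theorem wrapSum_eq_partialSum_sub {n : ℕ} (hn : 1 ≤ n) {y : ℕ → ℝ} (h : partialSum y n = 0)
    (k i : ℕ) :
    wrapSum n y k i = partialSum y ((k - 1 + i) % n) - partialSum y ((k - 1) % n) := by
  induction i with
  | zero => simp [wrapSum]
  | succ i ih =>
    have hstep : wrapSum n y k (i + 1) = wrapSum n y k i + y ((k - 1 + i) % n + 1) :=
      Finset.sum_range_succ _ _
    rw [hstep, ih, ← add_assoc, partialSum_succ_mod hn h, partialSum_succ]
    ring

/-- If `∑_{j=1}^n y_j = 0` and `m ∈ {1,…,n}` minimizes the partial sums `S_i`, then with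
`k*` the cyclic successor of `m` (i.e. `k* = m+1` if `m < n`, and `k* = 1` if `m = n`),
all partial sums with wrapping starting at `y_{k*}` are non-negative. -/
theorem wrapSum_nonneg_of_min (n : ℕ) (hn : 1 ≤ n) (y : ℕ → ℝ)
    (hsum : ∑ j ∈ Finset.Icc 1 n, y j = 0)
    (m : ℕ) (hm : m ∈ Finset.Icc 1 n)
    (hmin : ∀ i ∈ Finset.Icc 1 n, partialSum y m ≤ partialSum y i)
    (k : ℕ) (hk : k = if m < n then m + 1 else 1) :
    ∀ i ∈ Finset.Icc 1 n, 0 ≤ wrapSum n y k i := by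
  intro i _
  have h : partialSum y n = 0 := hsum
  obtain ⟨hm1, hmn⟩ := Finset.mem_Icc.mp hm
  have hstart : partialSum y ((k - 1) % n) = partialSum y m := by
    rcases hmn.lt_or_eq with hlt | rfl
    · simp [hk, hlt, Nat.mod_eq_of_lt hlt]
    · simp [hk, h, partialSum_zero]
  rw [wrapSum_eq_partialSum_sub hn h, hstart, sub_nonneg]
  have hlt : (k - 1 + i) % n < n := Nat.mod_lt _ hn
  rcases Nat.eq_zero_or_pos ((k - 1 + i) % n) with h0 | hpos
  · rw [h0, partialSum_zero, ← h]
    exact hmin n (Finset.mem_Icc.mpr ⟨hn, le_rfl⟩)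
  · exact hmin _ (Finset.mem_Icc.mpr ⟨hpos, hlt.le⟩)
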